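/- Suppose Θ > 1, Ω ≠ 1 and Γ ≠ 1, and set τ₁ = log α / log |I_min| and δ₆ = log(αγ) / log |I_min| − μ. Then: if Ω < 1 and Γ < 1, f₁ ∈ Lip min(λ, τ₁); if Ω > 1 and Γ > 1 and δ₆ > 0, f₁ ∈ Lip δ for every δ ∈ (0, δ₆]; if Ω > 1 and Γ < 1, f₁ ∈ Lip δ for every δ ∈ (0, τ₁]; if Ω < 1 and Γ > 1 and δ₆ > 0, f₁ ∈ Lip min(λ, δ₆). -/

import Mathlib

/-- Minimum of `g i` over `i = 1, …, N`. -/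
noncomputable def minOver (N : ℕ) (g : ℕ → ℝ) : ℝ := sInf (g '' Set.Icc 1 N)

/-- Maximum of `g i` over `i = 1, …, N`. -/
noncomputable def maxOver (N : ℕ) (g : ℕ → ℝ) : ℝ := sSup (g '' Set.Icc 1 N)

theorem minOver_le {N : ℕ} {g : ℕ → ℝ} {i : ℕ} (hi : i ∈ Set.Icc 1 N) : minOver N g ≤ g i :=
  csInf_le ((Set.finite_Icc 1 N).image g).bddBelow (Set.mem_image_of_mem g hi)

theorem le_maxOver {N : ℕ} {g : ℕ → ℝ} {i : ℕ} (hi : i ∈ Set.Icc 1 N) : g i ≤ maxOver N g :=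
  le_csSup ((Set.finite_Icc 1 N).image g).bddAbove (Set.mem_image_of_mem g hi)

theorem exists_eq_minOver {N : ℕ} (hN : 1 ≤ N) (g : ℕ → ℝ) :
    ∃ i ∈ Set.Icc 1 N, g i = minOver N g :=
  ((Set.nonempty_Icc.2 hN).image g).csInf_mem ((Set.finite_Icc 1 N).image g)

theorem exists_eq_maxOver {N : ℕ} (hN : 1 ≤ N) (g : ℕ → ℝ) :
    ∃ i ∈ Set.Icc 1 N, g i = maxOver N g :=
  ((Set.nonempty_Icc.2 hN).image g).csSup_mem ((Set.finite_Icc 1 N).image g)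

/-- An affine rescaling inequality propagates a Hölder bound from the pairs satisfying it directly
to all pairs in `S` that can be rescaled to such pairs. -/
theorem exists_holder_of_rescaling {N : ℕ} (hN : 1 ≤ N) {f : ℝ → ℝ} {ℓ b a : ℕ → ℝ}
    {S : ℝ → ℝ → Prop} {M K δ η : ℝ} (hM : 0 ≤ M) (hδ : 0 < δ) (hδη : δ ≤ η)
    (hℓ : ∀ i ∈ Set.Icc 1 N, 0 < ℓ i ∧ ℓ i < 1)
    (ha : (∀ i ∈ Set.Icc 1 N, |a i| < ℓ i ^ δ) ∨ (δ < η ∧ ∀ i ∈ Set.Icc 1 N, |a i| ≤ ℓ i ^ δ))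
    (hS : ∀ s t, S s t → |s - t| ≤ 1)
    (hf : ∀ i ∈ Set.Icc 1 N, ∀ s t, S s t →
      |f (ℓ i * s + b i) - f (ℓ i * t + b i)| ≤ |a i| * |f s - f t| + M * |s - t| ^ η)
    (hstep : ∀ s t, S s t → |f s - f t| ≤ K * |s - t| ^ δ ∨
      ∃ i ∈ Set.Icc 1 N, ∃ s' t', S s' t' ∧ s = ℓ i * s' + b i ∧ t = ℓ i * t' + b i) :
    ∃ C > 0, ∀ s t, S s t → |f s - f t| ≤ C * |s - t| ^ δ := by
  have hpow : ∀ d : ℝ, 0 ≤ d → d ≤ 1 → d ^ η ≤ d ^ δ := fun d h0 h1 =>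
    Real.rpow_le_rpow_of_exponent_ge' h0 h1 hδ.le hδη
  obtain ⟨A, B, hB, hA, hKA, hAB⟩ : ∃ A B : ℝ, 0 ≤ B ∧ 0 < A ∧ K ≤ A - B ∧
      ∀ i ∈ Set.Icc 1 N, ∀ d : ℝ, 0 ≤ d → d ≤ 1 →
        |a i| * (A * d ^ δ - B * d ^ η) + M * d ^ η ≤ A * (ℓ i * d) ^ δ - B * (ℓ i * d) ^ η := by
    rcases ha with ha | ⟨hlt, ha⟩
    · obtain ⟨j, hj, hjmin⟩ := exists_eq_minOver hN (fun i => ℓ i ^ δ - |a i|)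
      set κ := minOver N (fun i => ℓ i ^ δ - |a i|)
      have hκ : 0 < κ := by rw [← hjmin]; exact sub_pos.2 (ha j hj)
      refine ⟨max (max K 1) (M / κ), 0, le_rfl,
        lt_of_lt_of_le one_pos ((le_max_right _ _).trans (le_max_left _ _)),
        by rw [sub_zero]; exact (le_max_left _ _).trans (le_max_left _ _), fun i hi d h0 h1 => ?_⟩
      set A := max (max K 1) (M / κ)
      have hMA : M ≤ A * κ := (div_le_iff₀ hκ).1 (le_max_right _ _)
      have hA : 0 < A := lt_of_lt_of_le one_pos ((le_max_right _ _).trans (le_max_left _ _))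
      have hi' : κ ≤ ℓ i ^ δ - |a i| := minOver_le (g := fun i => ℓ i ^ δ - |a i|) hi
      rw [Real.mul_rpow (hℓ i hi).1.le h0]
      have h2 : M * d ^ η ≤ (A * (ℓ i ^ δ - |a i|)) * d ^ δ :=
        mul_le_mul (hMA.trans (mul_le_mul_of_nonneg_left hi' hA.le)) (hpow d h0 h1)
          (Real.rpow_nonneg h0 _) (mul_nonneg hA.le (hκ.le.trans hi'))
      linarith
    · obtain ⟨j, hj, hjmin⟩ := exists_eq_minOver hN (fun i => ℓ i ^ δ - ℓ i ^ η)
      set κ := minOver N (fun i => ℓ i ^ δ - ℓ i ^ η)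
      have hκ : 0 < κ := by
        rw [← hjmin]
        exact sub_pos.2 (Real.rpow_lt_rpow_of_exponent_gt (hℓ j hj).1 (hℓ j hj).2 hlt)
      have hB : 0 ≤ M / κ := by positivity
      refine ⟨max K 1 + M / κ, M / κ, hB, by positivity,
        by rw [add_sub_cancel_right]; exact le_max_left _ _, fun i hi d h0 h1 => ?_⟩
      have hA : 0 ≤ max K 1 := by positivity
      set A := max K 1
      have hMB : M = M / κ * κ := by field_simp
      set B := M / κ
      have hi' : κ ≤ ℓ i ^ δ - ℓ i ^ η := minOver_le (g := fun i => ℓ i ^ δ - ℓ i ^ η) hi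
      rw [Real.mul_rpow (hℓ i hi).1.le h0, Real.mul_rpow (hℓ i hi).1.le h0]
      have hd := Real.rpow_nonneg h0 η
      have hφ : 0 ≤ (A + B) * d ^ δ - B * d ^ η := by
        nlinarith [mul_nonneg hB (sub_nonneg.2 (hpow d h0 h1)),
          mul_nonneg hA (Real.rpow_nonneg h0 δ)]
      have h2 := mul_le_mul_of_nonneg_right (ha i hi) hφ
      have h3 : M * d ^ η ≤ B * (ℓ i ^ δ - ℓ i ^ η) * d ^ η := by
        refine mul_le_mul_of_nonneg_right ?_ hd
        rw [hMB]
        exact mul_le_mul_of_nonneg_left hi' hB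
      linarith
  obtain ⟨j, hj, hjmax⟩ := exists_eq_maxOver hN ℓ
  set Λ := maxOver N ℓ
  have hΛ0 : 0 < Λ := hjmax ▸ (hℓ j hj).1
  have hΛ1 : Λ < 1 := hjmax ▸ (hℓ j hj).2
  have hbase : ∀ s t, S s t → |f s - f t| ≤ K * |s - t| ^ δ →
      |f s - f t| ≤ A * |s - t| ^ δ - B * |s - t| ^ η := fun s t hst h => by
    have h1 := mul_le_mul_of_nonneg_left (hpow _ (abs_nonneg (s - t)) (hS s t hst)) hB
    have h2 := mul_le_mul_of_nonneg_right hKA (Real.rpow_nonneg (abs_nonneg (s - t)) δ)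
    linarith
  have hscale : ∀ i ∈ Set.Icc 1 N, ∀ s t : ℝ,
      |(ℓ i * s + b i) - (ℓ i * t + b i)| = ℓ i * |s - t| := fun i hi s t => by
    rw [add_sub_add_right_eq_sub, ← mul_sub, abs_mul, abs_of_pos (hℓ i hi).1]
  have key : ∀ n : ℕ, ∀ s t, S s t → Λ ^ n ≤ |s - t| →
      |f s - f t| ≤ A * |s - t| ^ δ - B * |s - t| ^ η := by
    intro n
    induction n with
    | zero =>
      intro s t hst hn
      rcases hstep s t hst with h | ⟨i, hi, s', t', hst', rfl, rfl⟩
      · exact hbase s t hst h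
      · rw [hscale i hi, pow_zero] at hn
        have := mul_le_mul_of_nonneg_left (hS s' t' hst') (hℓ i hi).1.le
        linarith [(hℓ i hi).2]
    | succ n ih =>
      intro s t hst hn
      rcases hstep s t hst with h | ⟨i, hi, s', t', hst', rfl, rfl⟩
      · exact hbase s t hst h
      · rw [hscale i hi] at hn ⊢
        have hn' : Λ ^ n ≤ |s' - t'| := by
          have h1 : ℓ i * |s' - t'| ≤ Λ * |s' - t'| :=
            mul_le_mul_of_nonneg_right (le_maxOver hi) (abs_nonneg _)
          rw [pow_succ, mul_comm] at hn
          exact le_of_mul_le_mul_left (hn.trans h1) hΛ0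
        have h1 := mul_le_mul_of_nonneg_left (ih s' t' hst' hn') (abs_nonneg (a i))
        have h2 := hAB i hi _ (abs_nonneg (s' - t')) (hS s' t' hst')
        have h3 := hf i hi s' t' hst'
        linarith
  refine ⟨A, hA, fun s t hst => ?_⟩
  rcases eq_or_ne s t with rfl | hne
  · simp [Real.zero_rpow hδ.ne']
  · obtain ⟨n, hn⟩ := exists_pow_lt_of_lt_one (abs_pos.2 (sub_ne_zero.2 hne)) hΛ1
    have h1 := key n s t hst hn.le
    have h2 := mul_nonneg hB (Real.rpow_nonneg (abs_nonneg (s - t)) η)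
    linarith

theorem nodes_lt_of_lt {N : ℕ} {x : ℕ → ℝ} (hx : ∀ i < N, x i < x (i + 1)) {i j : ℕ}
    (hij : i < j) (hj : j ≤ N) : x i < x j := by
  induction j, hij using Nat.le_induction with
  | base => exact hx i hj
  | succ k hk ih => exact (ih (by omega)).trans (hx k (by omega))

theorem exists_mem_Ico_nodes {N : ℕ} {x : ℕ → ℝ} {s : ℝ} (h0 : x 0 ≤ s) (hN : s < x N) :
    ∃ i < N, x i ≤ s ∧ s < x (i + 1) := by
  induction N with
  | zero => exact absurd hN h0.not_gt
  | succ n ih =>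
    rcases lt_or_ge s (x n) with h | h
    · obtain ⟨i, hi, hi'⟩ := ih h
      exact ⟨i, by omega, hi'⟩
    · exact ⟨n, by omega, h, hN⟩

theorem sub_nodes_mem_Ioo {N : ℕ} (hN : 2 ≤ N) {x : ℕ → ℝ} (hx0 : x 0 = 0) (hxN : x N = 1)
    (hx : ∀ i < N, x i < x (i + 1)) {i : ℕ} (hi : i ∈ Set.Icc 1 N) :
    0 < x i - x (i - 1) ∧ x i - x (i - 1) < 1 := by
  obtain ⟨h1, h2⟩ := hi
  refine ⟨sub_pos.2 (nodes_lt_of_lt hx (by omega) h2), ?_⟩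
  rcases h2.lt_or_eq with h | rfl
  · have h3 : x i < 1 := hxN ▸ nodes_lt_of_lt hx h le_rfl
    have h4 : 0 ≤ x (i - 1) := by
      rcases Nat.eq_zero_or_pos (i - 1) with h' | h'
      · rw [h', hx0]
      · exact hx0 ▸ (nodes_lt_of_lt hx h' (by omega)).le
    linarith
  · have h4 : 0 < x (i - 1) := hx0 ▸ nodes_lt_of_lt hx (show 0 < i - 1 by omega) (by omega)
    linarith

/-- A continuous solution of an affine self-referential equation with Hölder forcing is Hölder,
with an exponent `δ` for which the vertical scalings are dominated by `|I_i| ^ δ`. -/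
theorem exists_holder_of_self_affine {N : ℕ} (hN : 2 ≤ N) {x : ℕ → ℝ} (hx0 : x 0 = 0)
    (hxN : x N = 1) (hx : ∀ i < N, x i < x (i + 1)) {a : ℕ → ℝ} {r : ℕ → ℝ → ℝ} {f : ℝ → ℝ}
    (hfc : ContinuousOn f (Set.Icc 0 1))
    (hf : ∀ i ∈ Set.Icc 1 N, ∀ t ∈ Set.Icc (0 : ℝ) 1,
      f ((x i - x (i - 1)) * t + x (i - 1)) = a i * f t + r i t)
    {δ η : ℝ} (hδ : 0 < δ) (hδη : δ ≤ η)
    (ha : (∀ i ∈ Set.Icc 1 N, |a i| < (x i - x (i - 1)) ^ δ) ∨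
      (δ < η ∧ ∀ i ∈ Set.Icc 1 N, |a i| ≤ (x i - x (i - 1)) ^ δ))
    (hr : ∀ i ∈ Set.Icc 1 N, ∃ M > 0, ∀ s ∈ Set.Icc (0 : ℝ) 1, ∀ t ∈ Set.Icc (0 : ℝ) 1,
      |r i s - r i t| ≤ M * |s - t| ^ η) :
    ∃ C > 0, ∀ s ∈ Set.Icc (0 : ℝ) 1, ∀ t ∈ Set.Icc (0 : ℝ) 1,
      |f s - f t| ≤ C * |s - t| ^ δ := by
  have hN1 : 1 ≤ N := by omega
  have hℓ : ∀ i ∈ Set.Icc 1 N, 0 < x i - x (i - 1) ∧ x i - x (i - 1) < 1 :=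
    fun i hi => sub_nodes_mem_Ioo hN hx0 hxN hx hi
  obtain ⟨M, hM, hr⟩ : ∃ M ≥ 0, ∀ i ∈ Set.Icc 1 N, ∀ s ∈ Set.Icc (0 : ℝ) 1,
      ∀ t ∈ Set.Icc (0 : ℝ) 1, |r i s - r i t| ≤ M * |s - t| ^ η := by
    choose! g hg hg' using hr
    obtain ⟨j, hj, hjmax⟩ := exists_eq_maxOver hN1 g
    refine ⟨maxOver N g, hjmax ▸ (hg j hj).le, fun i hi s hs t ht => (hg' i hi s hs t ht).trans ?_⟩
    exact mul_le_mul_of_nonneg_right (le_maxOver hi) (Real.rpow_nonneg (abs_nonneg _) _)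
  obtain ⟨F, hF⟩ := isCompact_Icc.exists_bound_of_continuousOn hfc
  have hF0 : 0 ≤ F := (norm_nonneg _).trans (hF 0 (by simp))
  obtain ⟨j, hj, hjmin⟩ := exists_eq_minOver hN1 (fun i => x i - x (i - 1))
  have hm' : ∀ i ∈ Set.Icc 1 N, minOver N (fun i => x i - x (i - 1)) ≤ x i - x (i - 1) :=
    fun i hi => minOver_le (g := fun i => x i - x (i - 1)) hi
  set m := minOver N (fun i => x i - x (i - 1))
  have hm : 0 < m := hjmin ▸ (hℓ j hj).1
  have hmδ : 0 < m ^ δ := Real.rpow_pos_of_pos hm δ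
  have hK0 : 0 ≤ 2 * F / m ^ δ := by positivity
  have hfar : ∀ s ∈ Set.Icc (0 : ℝ) 1, ∀ t ∈ Set.Icc (0 : ℝ) 1, m ≤ |s - t| →
      |f s - f t| ≤ 2 * F / m ^ δ * |s - t| ^ δ := by
    intro s hs t ht hst
    have h1 : |f s - f t| ≤ 2 * F := by
      have h := abs_sub (f s) (f t)
      have hs' := hF s hs
      have ht' := hF t ht
      rw [Real.norm_eq_abs] at hs' ht'
      linarith
    calc |f s - f t| ≤ 2 * F / m ^ δ * m ^ δ := by rwa [div_mul_cancel₀ _ hmδ.ne']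
      _ ≤ _ := mul_le_mul_of_nonneg_left (Real.rpow_le_rpow hm.le hst hδ.le) hK0
  have haff : ∀ i ∈ Set.Icc 1 N, ∀ s ∈ Set.Icc (0 : ℝ) 1, ∀ t ∈ Set.Icc (0 : ℝ) 1,
      |f ((x i - x (i - 1)) * s + x (i - 1)) - f ((x i - x (i - 1)) * t + x (i - 1))|
        ≤ |a i| * |f s - f t| + M * |s - t| ^ η := by
    intro i hi s hs t ht
    rw [hf i hi s hs, hf i hi t ht, ← abs_mul]
    calc _ = |a i * (f s - f t) + (r i s - r i t)| := by congr 1; ring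
      _ ≤ |a i * (f s - f t)| + |r i s - r i t| := abs_add_le _ _
      _ ≤ _ := by gcongr; exact hr i hi s hs t ht
  have hinv : ∀ i ∈ Set.Icc 1 N, ∀ s ∈ Set.Icc (x (i - 1)) (x i), ∃ s' ∈ Set.Icc (0 : ℝ) 1,
      s = (x i - x (i - 1)) * s' + x (i - 1) := by
    intro i hi s hs
    have h := (hℓ i hi).1
    refine ⟨(s - x (i - 1)) / (x i - x (i - 1)), ⟨div_nonneg (sub_nonneg.2 hs.1) h.le,
      (div_le_one h).2 (sub_le_sub_right hs.2 _)⟩, ?_⟩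
    field_simp
    ring
  have hunit : ∀ s ∈ Set.Icc (0 : ℝ) 1, ∀ t ∈ Set.Icc (0 : ℝ) 1, |s - t| ≤ 1 := by
    intro s hs t ht
    rw [abs_le]
    constructor <;> linarith [hs.1, hs.2, ht.1, ht.2]
  have h01 : (0 : ℝ) ∈ Set.Icc (0 : ℝ) 1 := by simp
  have h11 : (1 : ℝ) ∈ Set.Icc (0 : ℝ) 1 := by simp
  have hone : 1 ∈ Set.Icc 1 N := ⟨le_rfl, hN1⟩
  have hlast : N ∈ Set.Icc 1 N := ⟨hN1, le_rfl⟩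
  obtain ⟨C₀, hC₀, hleft⟩ := exists_holder_of_rescaling hN1 (f := f) (b := fun i => x (i - 1))
    (S := fun s t => s = 0 ∧ t ∈ Set.Icc (0 : ℝ) 1) (K := 2 * F / m ^ δ) hM hδ hδη hℓ ha
    (by rintro s t ⟨rfl, ht⟩; exact hunit 0 h01 t ht)
    (by rintro i hi s t ⟨rfl, ht⟩; exact haff i hi 0 h01 t ht)
    (by
      rintro s t ⟨rfl, ht⟩
      rcases le_total t (x 1) with h | h
      · obtain ⟨t', ht', rfl⟩ := hinv 1 hone t ⟨by simpa [hx0] using ht.1, h⟩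
        exact Or.inr ⟨1, hone, 0, t', ⟨rfl, ht'⟩, by simp [hx0], rfl⟩
      · refine Or.inl (hfar 0 h01 t ht ?_)
        have := hm' 1 hone
        simp only [Nat.sub_self, hx0] at this
        rw [zero_sub, abs_neg, abs_of_nonneg ht.1]
        linarith)
  obtain ⟨C₁, hC₁, hright⟩ := exists_holder_of_rescaling hN1 (f := f) (b := fun i => x (i - 1))
    (S := fun s t => s ∈ Set.Icc (0 : ℝ) 1 ∧ t = 1) (K := 2 * F / m ^ δ) hM hδ hδη hℓ ha
    (by rintro s t ⟨hs, rfl⟩; exact hunit s hs 1 h11)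
    (by rintro i hi s t ⟨hs, rfl⟩; exact haff i hi s hs 1 h11)
    (by
      rintro s t ⟨hs, rfl⟩
      rcases le_total (x (N - 1)) s with h | h
      · obtain ⟨s', hs', rfl⟩ := hinv N hlast s ⟨h, hxN ▸ hs.2⟩
        exact Or.inr ⟨N, hlast, s', 1, ⟨hs', rfl⟩, rfl, by simp [hxN]⟩
      · refine Or.inl (hfar s hs 1 h11 ?_)
        have := hm' N hlast
        rw [hxN] at this
        rw [abs_sub_comm, abs_of_nonneg (sub_nonneg.2 hs.2)]
        linarith)
  -- Hölder bound at the endpoints of each subinterval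
  have hnode : ∃ D ≥ 0, ∀ i ∈ Set.Icc 1 N, ∀ s ∈ Set.Icc (x (i - 1)) (x i),
      |f s - f (x i)| ≤ D * |s - x i| ^ δ ∧ |f (x (i - 1)) - f s| ≤ D * |x (i - 1) - s| ^ δ := by
    refine ⟨(C₀ + C₁ + M) / m ^ δ, by positivity, fun i hi s hs => ?_⟩
    obtain ⟨s', hs', rfl⟩ := hinv i hi s hs
    have hℓi := hℓ i hi
    have hai : |a i| ≤ 1 := by
      have h1 := Real.rpow_le_one hℓi.1.le hℓi.2.le hδ.le
      rcases ha with h | ⟨-, h⟩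
      · exact (h i hi).le.trans h1
      · exact (h i hi).trans h1
    have hgen : ∀ u ∈ Set.Icc (0 : ℝ) 1, ∀ v ∈ Set.Icc (0 : ℝ) 1,
        |f u - f v| ≤ (C₀ + C₁) * |u - v| ^ δ →
        |f ((x i - x (i - 1)) * u + x (i - 1)) - f ((x i - x (i - 1)) * v + x (i - 1))| ≤
          (C₀ + C₁ + M) / m ^ δ * |((x i - x (i - 1)) * u + x (i - 1)) -
            ((x i - x (i - 1)) * v + x (i - 1))| ^ δ := by
      intro u hu v hv huv
      rw [add_sub_add_right_eq_sub, ← mul_sub, abs_mul, abs_of_pos hℓi.1,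
        Real.mul_rpow hℓi.1.le (abs_nonneg _)]
      have hd := Real.rpow_nonneg (abs_nonneg (u - v)) δ
      have h1 := mul_le_mul hai huv (abs_nonneg _) zero_le_one
      have h2 : M * |u - v| ^ η ≤ M * |u - v| ^ δ := mul_le_mul_of_nonneg_left
        (Real.rpow_le_rpow_of_exponent_ge' (abs_nonneg _) (hunit u hu v hv) hδ.le hδη) hM
      have h3 : m ^ δ ≤ (x i - x (i - 1)) ^ δ := Real.rpow_le_rpow hm.le (hm' i hi) hδ.le
      calc _ ≤ |a i| * |f u - f v| + M * |u - v| ^ η := haff i hi u hu v hv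
        _ ≤ (C₀ + C₁ + M) / m ^ δ * (m ^ δ * |u - v| ^ δ) := by
          rw [← mul_assoc, div_mul_cancel₀ _ hmδ.ne']
          linarith
        _ ≤ _ := by gcongr
    constructor
    · have h := hgen s' hs' 1 h11 ((hright s' 1 ⟨hs', rfl⟩).trans
        (mul_le_mul_of_nonneg_right (by linarith) (Real.rpow_nonneg (abs_nonneg _) _)))
      simpa using h
    · have h := hgen 0 h01 s' hs' ((hleft 0 s' ⟨rfl, hs'⟩).trans
        (mul_le_mul_of_nonneg_right (by linarith) (Real.rpow_nonneg (abs_nonneg _) _)))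
      simpa using h
  obtain ⟨D, hD, hnode⟩ := hnode
  obtain ⟨C, hC, hall⟩ := exists_holder_of_rescaling hN1 (f := f) (b := fun i => x (i - 1))
    (S := fun s t => s ∈ Set.Icc (0 : ℝ) 1 ∧ t ∈ Set.Icc (0 : ℝ) 1 ∧ s < t)
    (K := 2 * F / m ^ δ + 2 * D) hM hδ hδη hℓ ha
    (fun s t h => hunit s h.1 t h.2.1)
    (fun i hi s t h => haff i hi s h.1 t h.2.1)
    (by
      rintro s t ⟨hs, ht, hst⟩
      have hd := Real.rpow_nonneg (abs_nonneg (s - t)) δ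
      obtain ⟨i, hiN, hi1, hi2⟩ := exists_mem_Ico_nodes (x := x) (N := N) (s := s)
        (by rw [hx0]; exact hs.1) (by rw [hxN]; linarith [ht.2])
      have hi : i + 1 ∈ Set.Icc 1 N := ⟨by omega, hiN⟩
      rcases le_or_gt t (x (i + 1)) with h | h
      · obtain ⟨s', hs', hs''⟩ := hinv (i + 1) hi s ⟨hi1, hi2.le⟩
        obtain ⟨t', ht', ht''⟩ := hinv (i + 1) hi t ⟨hi1.trans hst.le, h⟩
        refine Or.inr ⟨i + 1, hi, s', t', ⟨hs', ht', ?_⟩, hs'', ht''⟩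
        rw [hs'', ht''] at hst
        exact lt_of_mul_lt_mul_left (by linarith) (hℓ (i + 1) hi).1.le
      · have hiN' : i + 1 < N := by
          by_contra hc
          have : i + 1 = N := by omega
          rw [this, hxN] at h
          linarith [ht.2]
        have hi' : i + 2 ∈ Set.Icc 1 N := ⟨by omega, hiN'⟩
        left
        rcases le_or_gt t (x (i + 2)) with h' | h'
        · have h1 := (hnode (i + 1) hi s ⟨hi1, hi2.le⟩).1
          have h2 := (hnode (i + 2) hi' t ⟨h.le, h'⟩).2
          simp only [Nat.add_succ_sub_one] at h2
          have h3 : |s - x (i + 1)| ^ δ ≤ |s - t| ^ δ := by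
            refine Real.rpow_le_rpow (abs_nonneg _) ?_ hδ.le
            rw [abs_sub_comm, abs_sub_comm s t, abs_of_pos (sub_pos.2 hi2),
              abs_of_pos (sub_pos.2 hst)]
            linarith
          have h4 : |x (i + 1) - t| ^ δ ≤ |s - t| ^ δ := by
            refine Real.rpow_le_rpow (abs_nonneg _) ?_ hδ.le
            rw [abs_sub_comm, abs_sub_comm s t, abs_of_pos (sub_pos.2 h),
              abs_of_pos (sub_pos.2 hst)]
            linarith
          have h5 := abs_sub_le (f s) (f (x (i + 1))) (f t)
          have h6 := mul_le_mul_of_nonneg_left h3 hD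
          have h7 := mul_le_mul_of_nonneg_left h4 hD
          have h8 := mul_nonneg hK0 hd
          linarith
        · have h1 := hm' (i + 2) hi'
          simp only [Nat.add_succ_sub_one] at h1
          have h2 := hfar s hs t ht (by
            rw [abs_sub_comm, abs_of_pos (sub_pos.2 hst)]
            linarith)
          have h3 := mul_nonneg hD hd
          linarith)
  refine ⟨C, hC, fun s hs t ht => ?_⟩
  rcases lt_trichotomy s t with h | rfl | h
  · exact hall s t ⟨hs, ht, h⟩
  · simp [Real.zero_rpow hδ.ne']
  · rw [abs_sub_comm, abs_sub_comm s]
    exact hall t s ⟨ht, hs, h⟩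

/-- Lowering the exponent of a Hölder bound on the unit interval. -/
theorem holder_mono_exponent {g : ℝ → ℝ} {M δ η : ℝ} (hM : 0 ≤ M) (hδ : 0 < δ) (hδη : δ ≤ η)
    (hg : ∀ s ∈ Set.Icc (0 : ℝ) 1, ∀ t ∈ Set.Icc (0 : ℝ) 1, |g s - g t| ≤ M * |s - t| ^ η) :
    ∀ s ∈ Set.Icc (0 : ℝ) 1, ∀ t ∈ Set.Icc (0 : ℝ) 1, |g s - g t| ≤ M * |s - t| ^ δ := by
  intro s hs t ht
  refine (hg s hs t ht).trans (mul_le_mul_of_nonneg_left ?_ hM)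
  refine Real.rpow_le_rpow_of_exponent_ge' (abs_nonneg _) ?_ hδ.le hδη
  rw [abs_le]
  constructor <;> linarith [hs.1, hs.2, ht.1, ht.2]

/-- If some ratio `|a i| / ℓ i ^ ν` exceeds one, then `log a / log ℓ_min` is below `ν`, where `a` is
the largest of the `|a i|` and `ℓ_min` the smallest of the `ℓ i`. -/
theorem maxOver_pos_and_log_div_log_lt {N : ℕ} (hN : 1 ≤ N) {ℓ a : ℕ → ℝ} {ν : ℝ}
    (hℓ : ∀ i ∈ Set.Icc 1 N, 0 < ℓ i ∧ ℓ i < 1) (hν : 0 < ν)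
    (h : 1 < maxOver N (fun i => |a i| / ℓ i ^ ν)) :
    0 < maxOver N (fun i => |a i|) ∧
      Real.log (maxOver N (fun i => |a i|)) / Real.log (minOver N ℓ) < ν := by
  obtain ⟨i, hi, him⟩ := exists_eq_maxOver hN (fun i => |a i| / ℓ i ^ ν)
  obtain ⟨j, hj, hjm⟩ := exists_eq_minOver hN ℓ
  have hm : 0 < minOver N ℓ := hjm ▸ (hℓ j hj).1
  have hm1 : minOver N ℓ < 1 := hjm ▸ (hℓ j hj).2
  have hlt : minOver N ℓ ^ ν < maxOver N (fun i => |a i|) := by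
    rw [← him, one_lt_div (Real.rpow_pos_of_pos (hℓ i hi).1 ν)] at h
    exact (Real.rpow_le_rpow hm.le (minOver_le hi) hν.le).trans_lt
      (h.trans_le (le_maxOver (g := fun i => |a i|) hi))
  have hpos := (Real.rpow_pos_of_pos hm ν).trans hlt
  refine ⟨hpos, ?_⟩
  rw [div_lt_iff_of_neg (Real.log_neg hm hm1), ← Real.log_rpow hm]
  exact Real.log_lt_log (Real.rpow_pos_of_pos hm ν) hlt

theorem abs_le_rpow_log_div_log {N : ℕ} (hN : 1 ≤ N) {ℓ a : ℕ → ℝ}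
    (hℓ : ∀ i ∈ Set.Icc 1 N, 0 < ℓ i ∧ ℓ i < 1) (ha : ∀ i ∈ Set.Icc 1 N, |a i| < 1)
    (hpos : 0 < maxOver N (fun i => |a i|)) :
    0 < Real.log (maxOver N (fun i => |a i|)) / Real.log (minOver N ℓ) ∧
      ∀ i ∈ Set.Icc 1 N,
        |a i| ≤ ℓ i ^ (Real.log (maxOver N (fun i => |a i|)) / Real.log (minOver N ℓ)) := by
  obtain ⟨j, hj, hjm⟩ := exists_eq_minOver hN ℓ
  obtain ⟨k, hk, hkm⟩ := exists_eq_maxOver hN (fun i => |a i|)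
  have hm : 0 < minOver N ℓ := hjm ▸ (hℓ j hj).1
  have hm1 : minOver N ℓ < 1 := hjm ▸ (hℓ j hj).2
  have hlog := Real.log_neg hm hm1
  have hτ : 0 < Real.log (maxOver N (fun i => |a i|)) / Real.log (minOver N ℓ) :=
    div_pos_of_neg_of_neg (Real.log_neg hpos (hkm ▸ ha k hk)) hlog
  refine ⟨hτ, fun i hi => (le_maxOver (g := fun i => |a i|) hi).trans ?_⟩
  refine le_trans (le_of_eq ?_) (Real.rpow_le_rpow hm.le (minOver_le hi) hτ.le)
  rw [Real.rpow_def_of_pos hm, mul_div_cancel₀ _ hlog.ne, Real.exp_log hpos]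

theorem abs_lt_rpow_of_maxOver_lt_one {N : ℕ} {ℓ a : ℕ → ℝ} {ν : ℝ}
    (hℓ : ∀ i ∈ Set.Icc 1 N, 0 < ℓ i ∧ ℓ i < 1)
    (h : maxOver N (fun i => |a i| / ℓ i ^ ν) < 1) : ∀ i ∈ Set.Icc 1 N, |a i| < ℓ i ^ ν :=
  fun i hi => (div_lt_one (Real.rpow_pos_of_pos (hℓ i hi).1 ν)).1
    ((le_maxOver (g := fun i => |a i| / ℓ i ^ ν) hi).trans_lt h)

/-- If `Θ > 1`, `Ω ≠ 1` and `Γ ≠ 1`, then `f₁ ∈ Lip δ` with `δ` as in each of the four subcases (with `τ₁ = log α / log |I_min|` and `δ₆ = log (αγ) / log |I_min| − μ`). -/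
theorem chfif_theta_gt_one_omega_ne_one_gamma_ne_one
    (N : ℕ) (hN : 2 ≤ N)
    (x : ℕ → ℝ) (hx0 : x 0 = 0) (hxN : x N = 1)
    (hxmono : ∀ i < N, x i < x (i + 1))
    (α β γ : ℕ → ℝ)
    (hα : ∀ i ∈ Set.Icc 1 N, |α i| < 1)
    (hβγ : ∀ i ∈ Set.Icc 1 N, |β i| + |γ i| < 1)
    (lam mu : ℕ → ℝ)
    (hlam : ∀ i ∈ Set.Icc 1 N, lam i ∈ Set.Ioc (0 : ℝ) 1)
    (hmu : ∀ i ∈ Set.Icc 1 N, mu i ∈ Set.Ioc (0 : ℝ) 1)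
    (p q : ℕ → ℝ → ℝ)
    (hp : ∀ i ∈ Set.Icc 1 N, ∃ M > 0, ∀ s ∈ Set.Icc (0 : ℝ) 1, ∀ t ∈ Set.Icc (0 : ℝ) 1,
      |p i s - p i t| ≤ M * |s - t| ^ lam i)
    (hq : ∀ i ∈ Set.Icc 1 N, ∃ M > 0, ∀ s ∈ Set.Icc (0 : ℝ) 1, ∀ t ∈ Set.Icc (0 : ℝ) 1,
      |q i s - q i t| ≤ M * |s - t| ^ mu i)
    (f₁ f₂ : ℝ → ℝ)
    (hf₁c : ContinuousOn f₁ (Set.Icc 0 1)) (hf₂c : ContinuousOn f₂ (Set.Icc 0 1))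
    (heq₁ : ∀ i ∈ Set.Icc 1 N, ∀ t ∈ Set.Icc (0 : ℝ) 1,
      f₁ ((x i - x (i - 1)) * t + x (i - 1)) = α i * f₁ t + β i * f₂ t + p i t)
    (heq₂ : ∀ i ∈ Set.Icc 1 N, ∀ t ∈ Set.Icc (0 : ℝ) 1,
      f₂ ((x i - x (i - 1)) * t + x (i - 1)) = γ i * f₂ t + q i t)
    (hΘ : 1 < maxOver N (fun i => |α i| / (x i - x (i - 1)) ^ minOver N mu))
    (hΩ : maxOver N (fun i => |α i| / (x i - x (i - 1)) ^ minOver N lam) ≠ 1)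
    (hΓ : maxOver N (fun i => |γ i| / (x i - x (i - 1)) ^ minOver N mu) ≠ 1)
    :
    ((maxOver N (fun i => |α i| / (x i - x (i - 1)) ^ minOver N lam) < 1 ∧ maxOver N (fun i => |γ i| / (x i - x (i - 1)) ^ minOver N mu) < 1) →
      ∃ C > 0, ∀ s ∈ Set.Icc (0 : ℝ) 1, ∀ t ∈ Set.Icc (0 : ℝ) 1,
      |f₁ s - f₁ t| ≤ C * |s - t| ^ (min (minOver N lam) (Real.log (maxOver N (fun i => |α i|)) / Real.log (minOver N (fun i => x i - x (i - 1)))))) ∧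
    ((1 < maxOver N (fun i => |α i| / (x i - x (i - 1)) ^ minOver N lam) ∧ 1 < maxOver N (fun i => |γ i| / (x i - x (i - 1)) ^ minOver N mu) ∧ 0 < Real.log ((maxOver N (fun i => |α i|)) * (maxOver N (fun i => |γ i|))) / Real.log (minOver N (fun i => x i - x (i - 1))) - minOver N mu) →
      ∀ δ : ℝ, 0 < δ → δ ≤ Real.log ((maxOver N (fun i => |α i|)) * (maxOver N (fun i => |γ i|))) / Real.log (minOver N (fun i => x i - x (i - 1))) - minOver N mu →
      ∃ C > 0, ∀ s ∈ Set.Icc (0 : ℝ) 1, ∀ t ∈ Set.Icc (0 : ℝ) 1,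
      |f₁ s - f₁ t| ≤ C * |s - t| ^ (δ)) ∧
    ((1 < maxOver N (fun i => |α i| / (x i - x (i - 1)) ^ minOver N lam) ∧ maxOver N (fun i => |γ i| / (x i - x (i - 1)) ^ minOver N mu) < 1) →
      ∀ δ : ℝ, 0 < δ → δ ≤ Real.log (maxOver N (fun i => |α i|)) / Real.log (minOver N (fun i => x i - x (i - 1))) →
      ∃ C > 0, ∀ s ∈ Set.Icc (0 : ℝ) 1, ∀ t ∈ Set.Icc (0 : ℝ) 1,
      |f₁ s - f₁ t| ≤ C * |s - t| ^ (δ)) ∧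
    ((maxOver N (fun i => |α i| / (x i - x (i - 1)) ^ minOver N lam) < 1 ∧ 1 < maxOver N (fun i => |γ i| / (x i - x (i - 1)) ^ minOver N mu) ∧ 0 < Real.log ((maxOver N (fun i => |α i|)) * (maxOver N (fun i => |γ i|))) / Real.log (minOver N (fun i => x i - x (i - 1))) - minOver N mu) →
      ∃ C > 0, ∀ s ∈ Set.Icc (0 : ℝ) 1, ∀ t ∈ Set.Icc (0 : ℝ) 1,
      |f₁ s - f₁ t| ≤ C * |s - t| ^ (min (minOver N lam) (Real.log ((maxOver N (fun i => |α i|)) * (maxOver N (fun i => |γ i|))) / Real.log (minOver N (fun i => x i - x (i - 1))) - minOver N mu))) := by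
  have hN1 : 1 ≤ N := by omega
  have hℓ : ∀ i ∈ Set.Icc 1 N, 0 < x i - x (i - 1) ∧ x i - x (i - 1) < 1 :=
    fun i hi => sub_nodes_mem_Ioo hN hx0 hxN hxmono hi
  have hlampos : 0 < minOver N lam := by
    obtain ⟨j, hj, hjm⟩ := exists_eq_minOver hN1 lam
    exact hjm ▸ (hlam j hj).1
  have hmupos : 0 < minOver N mu := by
    obtain ⟨j, hj, hjm⟩ := exists_eq_minOver hN1 mu
    exact hjm ▸ (hmu j hj).1
  have hγ : ∀ i ∈ Set.Icc 1 N, |γ i| < 1 := fun i hi => by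
    linarith [hβγ i hi, abs_nonneg (β i)]
  obtain ⟨hαpos, hτμ⟩ := maxOver_pos_and_log_div_log_lt hN1 hℓ hmupos hΘ
  obtain ⟨hτpos, hτ⟩ := abs_le_rpow_log_div_log hN1 hℓ hα hαpos
  have hf₂ : ∀ η, 0 < η → η ≤ minOver N mu → (∀ i ∈ Set.Icc 1 N, |γ i| < (x i - x (i - 1)) ^ η) →
      ∃ C > 0, ∀ s ∈ Set.Icc (0 : ℝ) 1, ∀ t ∈ Set.Icc (0 : ℝ) 1,
        |f₂ s - f₂ t| ≤ C * |s - t| ^ η := by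
    intro η hη hημ hγη
    refine exists_holder_of_self_affine hN hx0 hxN hxmono hf₂c heq₂ hη le_rfl (Or.inl hγη) ?_
    intro i hi
    obtain ⟨M, hM, hq⟩ := hq i hi
    exact ⟨M, hM, holder_mono_exponent hM.le hη (hημ.trans (minOver_le hi)) hq⟩
  have hf₁ : ∀ δ η, 0 < δ → δ ≤ η → η ≤ minOver N lam →
      ((∀ i ∈ Set.Icc 1 N, |α i| < (x i - x (i - 1)) ^ δ) ∨
        (δ < η ∧ ∀ i ∈ Set.Icc 1 N, |α i| ≤ (x i - x (i - 1)) ^ δ)) →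
      (∃ C > 0, ∀ s ∈ Set.Icc (0 : ℝ) 1, ∀ t ∈ Set.Icc (0 : ℝ) 1,
        |f₂ s - f₂ t| ≤ C * |s - t| ^ η) →
      ∃ C > 0, ∀ s ∈ Set.Icc (0 : ℝ) 1, ∀ t ∈ Set.Icc (0 : ℝ) 1,
        |f₁ s - f₁ t| ≤ C * |s - t| ^ δ := by
    rintro δ η hδ hδη hηlam hαδ ⟨C, hC, hf₂η⟩
    have hη := hδ.trans_le hδη
    refine exists_holder_of_self_affine hN hx0 hxN hxmono (r := fun i t => β i * f₂ t + p i t)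
      hf₁c (fun i hi t ht => by rw [heq₁ i hi t ht, add_assoc]) hδ hδη hαδ ?_
    intro i hi
    obtain ⟨M, hM, hp⟩ := hp i hi
    refine ⟨|β i| * C + M, by positivity, fun s hs t ht => ?_⟩
    have h1 := holder_mono_exponent hM.le hη (hηlam.trans (minOver_le hi)) hp s hs t ht
    have h2 := mul_le_mul_of_nonneg_left (hf₂η s hs t ht) (abs_nonneg (β i))
    calc |β i * f₂ s + p i s - (β i * f₂ t + p i t)|
        = |β i * (f₂ s - f₂ t) + (p i s - p i t)| := by congr 1; ring
      _ ≤ |β i * (f₂ s - f₂ t)| + |p i s - p i t| := abs_add_le _ _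
      _ ≤ _ := by rw [abs_mul]; linarith
  have hrpow : ∀ i ∈ Set.Icc 1 N, ∀ {u v : ℝ}, u < v →
      (x i - x (i - 1)) ^ v < (x i - x (i - 1)) ^ u := fun i hi _ _ huv =>
    Real.rpow_lt_rpow_of_exponent_gt (hℓ i hi).1 (hℓ i hi).2 huv
  -- For `Γ > 1`, both `τ₁` and `log γ / log |I_min|` lie below `μ`, hence above `δ₆`.
  have hδ₆ : 1 < maxOver N (fun i => |γ i| / (x i - x (i - 1)) ^ minOver N mu) →
      ∀ δ, 0 < δ → δ ≤ Real.log ((maxOver N (fun i => |α i|)) * (maxOver N (fun i => |γ i|))) /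
        Real.log (minOver N (fun i => x i - x (i - 1))) - minOver N mu → δ ≤ minOver N lam →
      ∃ C > 0, ∀ s ∈ Set.Icc (0 : ℝ) 1, ∀ t ∈ Set.Icc (0 : ℝ) 1,
        |f₁ s - f₁ t| ≤ C * |s - t| ^ δ := by
    intro hΓ' δ hδ hδle hδlam
    obtain ⟨hγpos, hτ₂μ⟩ := maxOver_pos_and_log_div_log_lt hN1 hℓ hmupos hΓ'
    obtain ⟨-, hτ₂⟩ := abs_le_rpow_log_div_log hN1 hℓ hγ hγpos
    rw [Real.log_mul hαpos.ne' hγpos.ne', add_div] at hδle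
    exact hf₁ δ δ hδ le_rfl hδlam
      (Or.inl fun i hi => (hτ i hi).trans_lt (hrpow i hi (by linarith)))
      (hf₂ δ hδ (by linarith) fun i hi => (hτ₂ i hi).trans_lt (hrpow i hi (by linarith)))
  -- For `Γ < 1`, the forcing term has exponent `min λ μ > τ₁` as soon as `τ₁ < λ`.
  have hτ₁ : maxOver N (fun i => |γ i| / (x i - x (i - 1)) ^ minOver N mu) < 1 →
      Real.log (maxOver N (fun i => |α i|)) /
        Real.log (minOver N (fun i => x i - x (i - 1))) < minOver N lam →
      ∀ δ, 0 < δ → δ ≤ Real.log (maxOver N (fun i => |α i|)) /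
        Real.log (minOver N (fun i => x i - x (i - 1))) →
      ∃ C > 0, ∀ s ∈ Set.Icc (0 : ℝ) 1, ∀ t ∈ Set.Icc (0 : ℝ) 1,
        |f₁ s - f₁ t| ≤ C * |s - t| ^ δ := by
    intro hΓ' hτlam δ hδ hδτ
    obtain ⟨C, hC, hf₂μ⟩ := hf₂ _ hmupos le_rfl (abs_lt_rpow_of_maxOver_lt_one hℓ hΓ')
    have hlt : δ < min (minOver N lam) (minOver N mu) :=
      lt_min (hδτ.trans_lt hτlam) (hδτ.trans_lt hτμ)
    refine hf₁ δ _ hδ hlt.le (min_le_left _ _) (Or.inr ⟨hlt, fun i hi => (hτ i hi).trans ?_⟩)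
      ⟨C, hC, holder_mono_exponent hC.le (hδ.trans hlt) (min_le_right _ _) hf₂μ⟩
    exact Real.rpow_le_rpow_of_exponent_ge (hℓ i hi).1 (hℓ i hi).2.le hδτ
  refine ⟨fun ⟨hΩ', hΓ'⟩ => ?_, fun ⟨hΩ', hΓ', _⟩ δ hδ hδle => ?_, fun ⟨hΩ', hΓ'⟩ => ?_,
    fun ⟨_, hΓ', hpos⟩ => hδ₆ hΓ' _ (lt_min hlampos hpos) (min_le_right _ _) (min_le_left _ _)⟩
  · rcases lt_or_ge (Real.log (maxOver N (fun i => |α i|)) /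
        Real.log (minOver N (fun i => x i - x (i - 1)))) (minOver N lam) with h | h
    · rw [min_eq_right h.le]
      exact hτ₁ hΓ' h _ hτpos le_rfl
    · rw [min_eq_left h]
      obtain ⟨C, hC, hf₂μ⟩ := hf₂ _ hmupos le_rfl (abs_lt_rpow_of_maxOver_lt_one hℓ hΓ')
      exact hf₁ _ _ hlampos le_rfl le_rfl (Or.inl (abs_lt_rpow_of_maxOver_lt_one hℓ hΩ'))
        ⟨C, hC, holder_mono_exponent hC.le hlampos (h.trans hτμ.le) hf₂μ⟩
  · obtain ⟨-, hτlam⟩ := maxOver_pos_and_log_div_log_lt hN1 hℓ hlampos hΩ'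
    obtain ⟨hγpos, hτ₂μ⟩ := maxOver_pos_and_log_div_log_lt hN1 hℓ hmupos hΓ'
    refine hδ₆ hΓ' δ hδ hδle ?_
    rw [Real.log_mul hαpos.ne' hγpos.ne', add_div] at hδle
    linarith
  · exact hτ₁ hΓ' (maxOver_pos_and_log_div_log_lt hN1 hℓ hlampos hΩ').2
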